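/- arXiv:2303.00103 — 6 statements merged into one kernel-verified Lean document; each statement's English description precedes it below -/
import Mathlib

section
/- Let ω := exp(2πi/3) and let U : ℂ → ℂ be U(z) := Σ_{k=0}^{2} ω^k · exp((z·conj(ω)^k − conj(z)·ω^k)/2). Then for all z ∈ ℂ: (i) for every a₁, a₂ ∈ ℤ, writing a := (4/3)·π·i·ω·(a₁ + ω·a₂), one has U(z + a) = conj(ω)^{a₁+a₂} · U(z); (ii) U(ω·z) = ω · U(z); (iii) conj(U(conj(z))) = U(z). -/
/-- `ω = exp(2πi/3)`. -/
noncomputable def ω : ℂ := Complex.exp (2 * Real.pi * Complex.I / 3)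

/-- The tunneling potential `U(z) = Σ_{k=0}^{2} ω^k exp((z ω̄^k − z̄ ω^k)/2)`. -/
noncomputable def U (z : ℂ) : ℂ :=
  ∑ k ∈ Finset.range 3,
    ω ^ k * Complex.exp ((z * (starRingEnd ℂ ω) ^ k - (starRingEnd ℂ z) * ω ^ k) / 2)

theorem om_sq : ω ^ 2 = -1 - ω := by
  have h := Complex.isPrimitiveRoot_exp 3 (by norm_num)
  have e : Complex.exp (2 * Real.pi * Complex.I / (3 : ℕ)) = ω := by
    simp [ω]
  rw [e] at h
  have h1 := h.pow_eq_one
  have h2 : ω - 1 ≠ 0 := sub_ne_zero.mpr (h.ne_one (by norm_num))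
  apply mul_left_cancel₀ h2
  linear_combination h1

theorem om_conj_exp : starRingEnd ℂ ω = Complex.exp (-(2 * Real.pi * Complex.I / 3)) := by
  rw [ω, ← Complex.exp_conj]
  congr 1
  simp [map_ofNat]
  ring

theorem om_conj : starRingEnd ℂ ω = -1 - ω := by
  have h : starRingEnd ℂ ω * ω = 1 := by
    rw [om_conj_exp, ω, ← Complex.exp_add]
    simp
  have h0 : ω ≠ 0 := Complex.exp_ne_zero _
  apply mul_right_cancel₀ h0
  rw [h]
  linear_combination om_sq

theorem U_eq (z : ℂ) : U z = Complex.exp ((z - starRingEnd ℂ z) / 2)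
    + ω * Complex.exp ((z * (-1 - ω) - starRingEnd ℂ z * ω) / 2)
    + (-1 - ω) * Complex.exp ((z * ω - starRingEnd ℂ z * (-1 - ω)) / 2) := by
  have h : (-1 - ω) ^ 2 = ω := by linear_combination om_sq
  simp only [U, Finset.sum_range_succ, Finset.sum_range_zero, om_conj, h, om_sq, pow_zero, pow_one,
    zero_add, one_mul, mul_one]

theorem exp_shift (n k : ℤ) (x y : ℂ)
    (h : x = y + n * (-(2 * Real.pi * Complex.I / 3)) + k * (2 * Real.pi * Complex.I)) :
    Complex.exp x = (starRingEnd ℂ ω) ^ n * Complex.exp y := by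
  rw [h, Complex.exp_add, Complex.exp_int_mul_two_pi_mul_I, Complex.exp_add, om_conj_exp,
    ← Complex.exp_int_mul]
  ring

/-- Symmetries of the potential `U`: translation quasi-periodicity, rotational
equivariance, and reality. -/
theorem U_symmetries (z : ℂ) :
    (∀ a₁ a₂ : ℤ,
        U (z + (4 / 3) * (Real.pi : ℂ) * Complex.I * ω * ((a₁ : ℂ) + ω * (a₂ : ℂ)))
          = (starRingEnd ℂ ω) ^ (a₁ + a₂) * U z) ∧
      U (ω * z) = ω * U z ∧
      starRingEnd ℂ (U (starRingEnd ℂ z)) = U z := by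
  refine ⟨fun a b => ?_, ?_, ?_⟩
  · have hs := om_sq
    have hc : starRingEnd ℂ (z + (4 / 3) * (Real.pi : ℂ) * Complex.I * ω * ((a : ℂ) + ω * (b : ℂ)))
        = starRingEnd ℂ z - (4 / 3) * (Real.pi : ℂ) * Complex.I * (a * (-1 - ω) + b * ω) := by
      simp only [map_add, map_mul, map_div₀, map_ofNat, Complex.conj_ofReal, Complex.conj_I,
        map_intCast, om_conj]
      linear_combination (-(4 / 3) * (Real.pi : ℂ) * Complex.I * b) * hs
    have e1 := exp_shift (a + b) 0 ((z + (4 / 3) * (Real.pi : ℂ) * Complex.I * ω * ((a : ℂ) + ω * (b : ℂ)) - (starRingEnd ℂ z - (4 / 3) * (Real.pi : ℂ) * Complex.I * (a * (-1 - ω) + b * ω))) / 2) ((z - starRingEnd ℂ z) / 2) (by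
      push_cast
      linear_combination (2 / 3 * (Real.pi : ℂ) * Complex.I * b) * hs)
    have e2 := exp_shift (a + b) a (((z + (4 / 3) * (Real.pi : ℂ) * Complex.I * ω * ((a : ℂ) + ω * (b : ℂ))) * (-1 - ω) - (starRingEnd ℂ z - (4 / 3) * (Real.pi : ℂ) * Complex.I * (a * (-1 - ω) + b * ω)) * ω) / 2)
      ((z * (-1 - ω) - starRingEnd ℂ z * ω) / 2) (by
      push_cast
      linear_combination (2 / 3 * (Real.pi : ℂ) * Complex.I * (-2 * a - b * (ω - 1))) * hs)
    have e3 := exp_shift (a + b) b (((z + (4 / 3) * (Real.pi : ℂ) * Complex.I * ω * ((a : ℂ) + ω * (b : ℂ))) * ω - (starRingEnd ℂ z - (4 / 3) * (Real.pi : ℂ) * Complex.I * (a * (-1 - ω) + b * ω)) * (-1 - ω)) / 2)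
      ((z * ω - starRingEnd ℂ z * (-1 - ω)) / 2) (by
      push_cast
      linear_combination (2 / 3 * (Real.pi : ℂ) * Complex.I * (2 * a + b * (ω - 2))) * hs)
    rw [U_eq, U_eq, hc, e1, e2, e3]
    ring
  · have hs := om_sq
    rw [U_eq, U_eq, map_mul, om_conj]
    have e1 : (ω * z - (-1 - ω) * starRingEnd ℂ z) / 2
      = (z * ω - starRingEnd ℂ z * (-1 - ω)) / 2 := by ring
    have e2 : (ω * z * (-1 - ω) - (-1 - ω) * starRingEnd ℂ z * ω) / 2
      = (z - starRingEnd ℂ z) / 2 := by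
      linear_combination ((starRingEnd ℂ z - z) / 2) * hs
    have e3 : (ω * z * ω - (-1 - ω) * starRingEnd ℂ z * (-1 - ω)) / 2
      = (z * (-1 - ω) - starRingEnd ℂ z * ω) / 2 := by
      linear_combination ((z - starRingEnd ℂ z) / 2) * hs
    rw [e1, e2, e3]
    generalize Complex.exp ((z - starRingEnd ℂ z) / 2) = A
    generalize Complex.exp ((z * ω - starRingEnd ℂ z * (-1 - ω)) / 2) = B
    generalize Complex.exp ((z * (-1 - ω) - starRingEnd ℂ z * ω) / 2) = C
    linear_combination (B - C) * hs
  · rw [U_eq, U_eq]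
    simp only [map_add, map_sub, map_mul, map_neg, map_one, map_div₀, map_ofNat,
      ← Complex.exp_conj, Complex.conj_conj, om_conj]
    ring_nf
end

section
/- Let R be a unital ring, let t₁, …, t_{n−1} be elements of the center of R, let A be any 2×2 matrix over R, and let b ∈ R have a two-sided inverse r. Set B := diag(b, b), R₀ := diag(r, r), T₊ := E₁₁ (the 2×2 matrix with 1 in position (1,1) and 0 elsewhere), and T₋ := E₂₂. Let 𝐃 be the n×n block matrix (with 2×2 blocks over R) with 𝐃₁₁ = A, 𝐃_{jj} = B for 2 ≤ j ≤ n, 𝐃_{j,j+1} = t_j·T₊, 𝐃_{j+1,j} = t_j·T₋ for 1 ≤ j ≤ n−1, and all other blocks 0. Let J₊ be the n×n block matrix with (J₊)_{j,j+1} = t_j·T₊·R₀ for 1 ≤ j ≤ n−1 and all other blocks 0, and let J₋ have (J₋)_{j+1,j} = t_j·T₋·R₀ for 1 ≤ j ≤ n−1 and all other blocks 0. Then 𝐃 = (I + J₊) · diag(A, B, …, B) · (I + J₋). -/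
open Matrix

/-- `T₊ = E₁₁`. -/
def Tplus (R : Type*) [Ring R] : Matrix (Fin 2) (Fin 2) R := !![1, 0; 0, 0]

/-- `T₋ = E₂₂`. -/
def Tminus (R : Type*) [Ring R] : Matrix (Fin 2) (Fin 2) R := !![0, 0; 0, 1]

/-- The `n×n` block-tridiagonal matrix `𝐃` with `𝐃₁₁ = A`, `𝐃_{jj} = diag(b,b)`
for `2 ≤ j ≤ n`, `𝐃_{j,j+1} = t_j T₊` and `𝐃_{j+1,j} = t_j T₋` (1-based block
indices; `t` is indexed so that blocks `j` and `j+1` are coupled by `t j`). -/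
def multiD {R : Type*} [Ring R] (n : ℕ) (t : ℕ → R)
    (A : Matrix (Fin 2) (Fin 2) R) (b : R) :
    Matrix (Fin n) (Fin n) (Matrix (Fin 2) (Fin 2) R) :=
  Matrix.of fun i j =>
    if i = j then (if (i : ℕ) = 0 then A else !![b, 0; 0, b])
    else if (j : ℕ) = (i : ℕ) + 1 then t ((i : ℕ) + 1) • Tplus R
    else if (i : ℕ) = (j : ℕ) + 1 then t ((j : ℕ) + 1) • Tminus R
    else 0

/-- The strictly upper-triangular block matrix `J₊` with `(J₊)_{j,j+1} = t_j T₊ R₀`,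
`R₀ = diag(r,r)`. -/
def Jplus {R : Type*} [Ring R] (n : ℕ) (t : ℕ → R) (r : R) :
    Matrix (Fin n) (Fin n) (Matrix (Fin 2) (Fin 2) R) :=
  Matrix.of fun i j =>
    if (j : ℕ) = (i : ℕ) + 1 then t ((i : ℕ) + 1) • (Tplus R * !![r, 0; 0, r]) else 0

/-- The strictly lower-triangular block matrix `J₋` with `(J₋)_{j+1,j} = t_j T₋ R₀`. -/
def Jminus {R : Type*} [Ring R] (n : ℕ) (t : ℕ → R) (r : R) :
    Matrix (Fin n) (Fin n) (Matrix (Fin 2) (Fin 2) R) :=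
  Matrix.of fun i j =>
    if (i : ℕ) = (j : ℕ) + 1 then t ((j : ℕ) + 1) • (Tminus R * !![r, 0; 0, r]) else 0

/-- The block-diagonal matrix `diag(A, B, …, B)` with `B = diag(b,b)`. -/
def diagABB {R : Type*} [Ring R] (n : ℕ) (A : Matrix (Fin 2) (Fin 2) R) (b : R) :
    Matrix (Fin n) (Fin n) (Matrix (Fin 2) (Fin 2) R) :=
  Matrix.of fun i j =>
    if i = j then (if (i : ℕ) = 0 then A else !![b, 0; 0, b]) else 0

/-- The block tridiagonal factorization
`𝐃 = (I + J₊) · diag(A, B, …, B) · (I + J₋)` where `r` is a two-sided inverse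
of `b` and the tunneling coefficients `t_j` are central. -/
theorem multiD_factorization {R : Type*} [Ring R] (n : ℕ) (hn : 1 ≤ n)
    (t : ℕ → R) (ht : ∀ j, ∀ x : R, t j * x = x * t j)
    (A : Matrix (Fin 2) (Fin 2) R) (b r : R) (hbr : b * r = 1) (hrb : r * b = 1) :
    multiD n t A b = (1 + Jplus n t r) * diagABB n A b * (1 + Jminus n t r) := by
  classical
  set d : Fin n → Matrix (Fin 2) (Fin 2) R :=
    fun i => if (i : ℕ) = 0 then A else !![b, 0; 0, b] with hd
  have hD : diagABB n A b = Matrix.diagonal d := by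
    ext1 i j
    simp [diagABB, Matrix.diagonal, hd]
  have h1 : Jplus n t r * diagABB n A b =
      Matrix.of fun i j : Fin n =>
        if (j : ℕ) = (i : ℕ) + 1 then t ((i : ℕ) + 1) • Tplus R else 0 := by
    rw [hD]
    ext1 i j
    rw [Matrix.mul_diagonal]
    simp only [Jplus, Matrix.of_apply, hd]
    by_cases h : (j : ℕ) = (i : ℕ) + 1
    · have hj : (j : ℕ) ≠ 0 := by omega
      rw [if_pos h, if_neg hj, if_pos h]
      ext a c
      fin_cases a <;> fin_cases c <;>
        simp [Tplus, Matrix.mul_apply, Fin.sum_univ_two, mul_assoc, hrb]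
    · simp [h]
  have h2 : diagABB n A b * Jminus n t r =
      Matrix.of fun i j : Fin n =>
        if (i : ℕ) = (j : ℕ) + 1 then t ((j : ℕ) + 1) • Tminus R else 0 := by
    rw [hD]
    ext1 i j
    rw [Matrix.diagonal_mul]
    simp only [Jminus, Matrix.of_apply, hd]
    by_cases h : (i : ℕ) = (j : ℕ) + 1
    · have hj : (i : ℕ) ≠ 0 := by omega
      rw [if_pos h, if_neg hj, if_pos h]
      ext a c
      fin_cases a <;> fin_cases c <;>
        simp [Tminus, Matrix.mul_apply, Fin.sum_univ_two, ht, ← mul_assoc, hbr]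
    · simp [h]
  have h3 : Jplus n t r * diagABB n A b * Jminus n t r = 0 := by
    rw [h1]
    ext1 i j
    rw [Matrix.mul_apply]
    apply Finset.sum_eq_zero
    intro k _
    simp only [Jminus, Matrix.of_apply]
    split_ifs
    · ext a c
      fin_cases a <;> fin_cases c <;>
        simp [Tplus, Tminus, Matrix.mul_apply, Fin.sum_univ_two]
    all_goals simp
  have h4 : (1 + Jplus n t r) * diagABB n A b * (1 + Jminus n t r) =
      diagABB n A b + Jplus n t r * diagABB n A b + diagABB n A b * Jminus n t r
        + Jplus n t r * diagABB n A b * Jminus n t r := by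
    noncomm_ring
  rw [h4, h3, h1, h2]
  ext1 i j
  simp only [multiD, diagABB, Matrix.add_apply, Matrix.of_apply, Matrix.zero_apply, add_zero]
  by_cases e : i = j
  · subst e
    simp
  · by_cases e1 : (j : ℕ) = (i : ℕ) + 1
    · have e2 : ¬ (i : ℕ) = (j : ℕ) + 1 := by omega
      simp only [if_neg e, if_pos e1, if_neg e2, zero_add, add_zero]
    · simp only [if_neg e, if_neg e1, zero_add]
end

section
/- Let R be a unital ring, let t₁, …, t_{n−1} be elements of the center of R, let A be any 2×2 matrix over R, and let b ∈ R have a two-sided inverse r. Set B := diag(b, b), T₊ := E₁₁, T₋ := E₂₂, and let 𝐃 be the n×n block matrix (with 2×2 blocks over R) with 𝐃₁₁ = A, 𝐃_{jj} = B for 2 ≤ j ≤ n, 𝐃_{j,j+1} = t_j·T₊, 𝐃_{j+1,j} = t_j·T₋ for 1 ≤ j ≤ n−1, and all other blocks 0. Then 𝐃 is invertible (as a 2n×2n matrix over R) if and only if A is invertible (as a 2×2 matrix over R). -/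
open Matrix

theorem aux_nilp {S : Type*} [Ring S] {n : ℕ} (f : Fin n → ℕ) (hf : ∀ i, f i < n)
    (N : Matrix (Fin n) (Fin n) S) (h : ∀ i j, f j ≤ f i → N i j = 0) : IsUnit (1 + N) := by
  have key : ∀ k : ℕ, ∀ i j, f j < f i + k → (N ^ k) i j = 0 := by
    intro k
    induction k with
    | zero =>
      intro i j hij
      rw [pow_zero, Matrix.one_apply_ne]
      rintro rfl
      omega
    | succ k ih =>
      intro i j hij
      rw [pow_succ, Matrix.mul_apply]
      refine Finset.sum_eq_zero fun l _ => ?_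
      by_cases hl : f l < f i + k
      · rw [ih i l hl, zero_mul]
      · rw [h l j (by omega), mul_zero]
  have hN : IsNilpotent N := by
    refine ⟨n, ?_⟩
    ext1 i j
    exact key n i j (by have := hf j; omega)
  exact hN.isUnit_one_add

theorem aux_diag {S : Type*} [Ring S] {n : ℕ} (i₀ : Fin n) (d : Fin n → S)
    (h : ∀ i, i ≠ i₀ → IsUnit (d i)) : IsUnit (Matrix.diagonal d) ↔ IsUnit (d i₀) := by
  constructor
  · intro hu
    obtain ⟨X, h1, h2⟩ := isUnit_iff_exists.mp hu
    refine isUnit_iff_exists.mpr ⟨X i₀ i₀, ?_, ?_⟩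
    · have := congrFun (congrFun h1 i₀) i₀
      simpa [Matrix.diagonal_mul] using this
    · have := congrFun (congrFun h2 i₀) i₀
      simpa [Matrix.mul_diagonal] using this
  · intro hu
    have : IsUnit d := by
      rw [Pi.isUnit_iff]
      intro i
      by_cases hi : i = i₀
      · rw [hi]; exact hu
      · exact h i hi
    exact this.map (Matrix.diagonalRingHom (Fin n) S)

/-- Abstract core of Theorem 1: the multilayer operator `𝐃` is invertible if and
only if its top-left block `A` is invertible, given that `b` has a two-sided
inverse and the tunneling coefficients `t_j` are central. -/
theorem multiD_isUnit_iff {R : Type*} [Ring R] (n : ℕ) (hn : 1 ≤ n)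
    (t : ℕ → R) (ht : ∀ j, ∀ x : R, t j * x = x * t j)
    (A : Matrix (Fin 2) (Fin 2) R) (b r : R) (hbr : b * r = 1) (hrb : r * b = 1) :
    IsUnit (multiD n t A b) ↔ IsUnit A := by
  set B : Matrix (Fin 2) (Fin 2) R := !![b, 0; 0, b] with hB
  set C : Matrix (Fin 2) (Fin 2) R := !![r, 0; 0, r] with hC
  have hBC : B * C = 1 := by
    simp [hB, hC, Matrix.mul_fin_two, hbr, Matrix.one_fin_two]
  have hCB : C * B = 1 := by
    simp [hB, hC, Matrix.mul_fin_two, hrb, Matrix.one_fin_two]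
  have hTT : ∀ x y : R, (x • Tplus R) * C * (y • Tminus R) = 0 := by
    intro x y
    ext i j
    fin_cases i <;> fin_cases j <;> simp [Tplus, Tminus, hC, Matrix.mul_apply, Fin.sum_univ_two]
  let d : Fin n → Matrix (Fin 2) (Fin 2) R := fun i => if (i : ℕ) = 0 then A else B
  let G : Matrix (Fin n) (Fin n) (Matrix (Fin 2) (Fin 2) R) := Matrix.diagonal fun _ => C
  let P : Matrix (Fin n) (Fin n) (Matrix (Fin 2) (Fin 2) R) :=
    Matrix.of fun i j => if (j : ℕ) = (i : ℕ) + 1 then t ((i : ℕ) + 1) • Tplus R else 0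
  let Q : Matrix (Fin n) (Fin n) (Matrix (Fin 2) (Fin 2) R) :=
    Matrix.of fun i j => if (i : ℕ) = (j : ℕ) + 1 then t ((j : ℕ) + 1) • Tminus R else 0
  have hD : multiD n t A b = Matrix.diagonal d + P + Q := by
    ext1 i j
    simp only [multiD, Matrix.add_apply, Matrix.of_apply, Matrix.diagonal_apply, d, P, Q]
    by_cases h1 : i = j
    · subst h1; simp [hB]
    · by_cases h2 : (j : ℕ) = (i : ℕ) + 1
      · have h3 : ¬ (i : ℕ) = (j : ℕ) + 1 := by omega
        rw [if_neg h1, if_pos h2, if_neg h1, if_pos h2, if_neg h3]; simp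
      · rw [if_neg h1, if_neg h2, if_neg h1, if_neg h2]; simp
  have e1 : P * G * Matrix.diagonal d = P := by
    ext1 i j
    simp only [G, Matrix.mul_diagonal, P, Matrix.of_apply, d]
    by_cases h2 : (j : ℕ) = (i : ℕ) + 1
    · rw [if_neg (show ¬ (j : ℕ) = 0 by omega), mul_assoc, hCB, mul_one]
    · rw [if_neg h2, zero_mul, zero_mul]
  have e2 : Matrix.diagonal d * (G * Q) = Q := by
    ext1 i j
    simp only [G, Matrix.diagonal_mul, Q, Matrix.of_apply, d]
    by_cases h2 : (i : ℕ) = (j : ℕ) + 1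
    · rw [if_neg (show ¬ (i : ℕ) = 0 by omega), ← mul_assoc, hBC, one_mul]
    · rw [if_neg h2, mul_zero, mul_zero]
  have e3 : P * (G * Q) = 0 := by
    ext1 i j
    rw [← mul_assoc, Matrix.mul_apply]
    refine Finset.sum_eq_zero fun l _ => ?_
    simp only [G, Matrix.mul_diagonal, P, Q, Matrix.of_apply]
    split_ifs
    · exact hTT _ _
    · exact mul_zero _
    · rw [zero_mul, zero_mul]
    · rw [mul_zero]
  have hfac : multiD n t A b = (1 + P * G) * Matrix.diagonal d * (1 + G * Q) := by
    rw [add_mul 1 (P * G), one_mul, e1, mul_add, mul_one, add_mul, e2, e3, add_zero, hD]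
  have u1 : IsUnit (1 + P * G) := by
    refine aux_nilp (fun i => (i : ℕ)) (fun i => i.2) _ ?_
    intro i j hij
    simp only [G, Matrix.mul_diagonal, P, Matrix.of_apply]
    rw [if_neg (by omega), zero_mul]
  have u2 : IsUnit (1 + G * Q) := by
    refine aux_nilp (fun i => n - 1 - (i : ℕ)) (fun i => by omega) _ ?_
    intro i j hij
    simp only [G, Matrix.diagonal_mul, Q, Matrix.of_apply]
    rw [if_neg (by omega), mul_zero]
  rw [hfac]
  obtain ⟨v1, hv1⟩ := u1
  obtain ⟨v2, hv2⟩ := u2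
  rw [← hv1, ← hv2, Units.isUnit_mul_units, Units.isUnit_units_mul,
    aux_diag ⟨0, hn⟩ d]
  · simp [d]
  · intro i hi
    have : ¬ (i : ℕ) = 0 := fun h => hi (Fin.ext h)
    simp only [d, if_neg this]
    exact isUnit_iff_exists.mpr ⟨C, hBC, hCB⟩
end

section
/- Let ω := exp(2πi/3) and define θ : ℂ → ℂ by θ(ζ) := −Σ_{n∈ℤ} exp(πi·(n + 1/2)²·ω + 2πi·(n + 1/2)·(ζ + 1/2)). Then θ is entire (complex-analytic on all of ℂ), θ(ζ) = 0 if and only if ζ ∈ ℤ + ω·ℤ, and every zero is simple: the complex derivative θ′(ζ) is nonzero at every ζ ∈ ℤ + ω·ℤ. -/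
/-- The odd Jacobi theta function
`θ(ζ) = −Σ_{n∈ℤ} exp(πi(n+1/2)²ω + 2πi(n+1/2)(ζ+1/2))` with modular parameter `ω`. -/
noncomputable def θf (ζ : ℂ) : ℂ :=
  -∑' n : ℤ, Complex.exp ((Real.pi : ℂ) * Complex.I * ((n : ℂ) + 1 / 2) ^ 2 * ω
      + 2 * (Real.pi : ℂ) * Complex.I * ((n : ℂ) + 1 / 2) * (ζ + 1 / 2))


open Complex in
lemma om_re_im : ω = -1/2 + (Real.sqrt 3 / 2 : ℝ) * I := by
  unfold ω
  have h : (2 * Real.pi * I / 3 : ℂ) = ((Real.pi - Real.pi / 3 : ℝ) : ℂ) * I := by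
    push_cast; ring
  rw [h, exp_mul_I, ← ofReal_cos, ← ofReal_sin, Real.cos_pi_sub, Real.sin_pi_sub,
    Real.cos_pi_div_three, Real.sin_pi_div_three]
  push_cast; ring

lemma om_im : ω.im = Real.sqrt 3 / 2 := by
  rw [om_re_im]; simp

lemma om_im_pos : 0 < ω.im := by rw [om_im]; positivity

open Complex in
lemma th_term (n : ℤ) (ζ : ℂ) :
    Complex.exp ((Real.pi : ℂ) * Complex.I * ((n : ℂ) + 1 / 2) ^ 2 * ω
      + 2 * (Real.pi : ℂ) * Complex.I * ((n : ℂ) + 1 / 2) * (ζ + 1 / 2)) =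
    exp (Real.pi * I * ω / 4 + Real.pi * I * (ζ + 1/2)) *
      jacobiTheta₂_term n (ζ + 1/2 + ω/2) ω := by
  unfold jacobiTheta₂_term
  rw [← exp_add]; congr 1; ring

open Complex in
lemma th_eq (ζ : ℂ) : θf ζ = -(exp (Real.pi * I * ω / 4 + Real.pi * I * (ζ + 1/2)) *
      jacobiTheta₂ (ζ + 1/2 + ω/2) ω) := by
  unfold θf jacobiTheta₂
  simp_rw [th_term]
  rw [tsum_mul_left]

lemma th_diff : Differentiable ℂ θf := by
  have : θf = _ := funext th_eq
  rw [this]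
  intro z
  have h := differentiableAt_jacobiTheta₂_fst (z + 1/2 + ω/2) om_im_pos
  have h2 : DifferentiableAt ℂ (fun ζ : ℂ => jacobiTheta₂ (ζ + 1/2 + ω/2) ω) z :=
    DifferentiableAt.comp z (f := fun ζ : ℂ => ζ + 1/2 + ω/2) h (by fun_prop)
  fun_prop

open Complex in
lemma th_add_one (ζ : ℂ) : θf (ζ + 1) = -θf ζ := by
  rw [th_eq, th_eq, show ζ + 1 + 1/2 + ω/2 = (ζ + 1/2 + ω/2) + 1 by ring, jacobiTheta₂_add_left,
    show (Real.pi * I * ω / 4 + Real.pi * I * (ζ + 1 + 1/2) : ℂ) =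
      (Real.pi * I * ω / 4 + Real.pi * I * (ζ + 1/2)) + Real.pi * I by ring, exp_add _ (Real.pi * I : ℂ), exp_pi_mul_I]
  ring

open Complex in
lemma th_add_om (ζ : ℂ) : θf (ζ + ω) = -exp (-Real.pi * I * (ω + 2 * ζ)) * θf ζ := by
  rw [th_eq, th_eq, show ζ + ω + 1/2 + ω/2 = (ζ + 1/2 + ω/2) + ω by ring, jacobiTheta₂_add_left']
  have : exp (Real.pi * I * ω / 4 + Real.pi * I * (ζ + ω + 1/2)) *
      exp (-Real.pi * I * (ω + 2 * (ζ + 1/2 + ω/2))) =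
      -(exp (-Real.pi * I * (ω + 2 * ζ)) *
        exp (Real.pi * I * ω / 4 + Real.pi * I * (ζ + 1/2))) := by
    have hI : exp (-(Real.pi * I)) = -1 := by rw [exp_neg, exp_pi_mul_I]; norm_num
    rw [← exp_add, ← exp_add, ← neg_one_mul (exp _)]
    rw [← hI]
    rw [← exp_add]
    congr 1; ring
  linear_combination (-jacobiTheta₂ (ζ + 1/2 + ω/2) ω) * this

lemma zero_add_one (ζ : ℂ) : θf (ζ + 1) = 0 ↔ θf ζ = 0 := by
  rw [th_add_one, neg_eq_zero]

lemma zero_add_om (ζ : ℂ) : θf (ζ + ω) = 0 ↔ θf ζ = 0 := by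
  rw [th_add_om]; simp [Complex.exp_ne_zero]

open Complex in
lemma deriv_add_one (ζ : ℂ) : deriv θf (ζ + 1) = 0 ↔ deriv θf ζ = 0 := by
  rw [← deriv_comp_add_const, funext th_add_one, deriv.fun_neg, neg_eq_zero]

open Complex in
lemma deriv_add_om (ζ : ℂ) (h : θf ζ = 0) : deriv θf (ζ + ω) = 0 ↔ deriv θf ζ = 0 := by
  rw [← deriv_comp_add_const, funext th_add_om, deriv_fun_mul (by fun_prop) (th_diff ζ), h]
  simp [Complex.exp_ne_zero]

lemma inv_shift (P : ℂ → Prop) (a : ℂ) (h : ∀ z, P (z + a) ↔ P z) (z : ℂ) (n : ℤ) :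
    P (z + n * a) ↔ P z := by
  induction n using Int.induction_on with
  | zero => simp
  | succ k ih =>
    rw [← ih, ← h (z + ((k : ℤ) : ℂ) * a)]; push_cast; ring_nf
  | pred k ih =>
    rw [← ih, ← h]; push_cast; ring_nf

open Complex in
lemma norm_cos_le' (w : ℂ) : ‖Complex.cos w‖ ≤ Real.exp |w.im| := by
  unfold Complex.cos
  rw [norm_div]
  have h1 : ‖exp (w * I)‖ ≤ Real.exp |w.im| := by
    rw [norm_exp]; simp; exact neg_le_abs _
  have h2 : ‖exp (-w * I)‖ ≤ Real.exp |w.im| := by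
    rw [norm_exp]; simp; exact le_abs_self _
  have := norm_add_le (exp (w * I)) (exp (-w * I))
  simp only [Complex.norm_ofNat]
  linarith

lemma norm_sin_odd (z : ℂ) (n : ℕ) :
    ‖Complex.sin ((2 * n + 1) * z)‖ ≤ (2 * n + 1) * Real.exp (2 * n * |z.im|) * ‖Complex.sin z‖ := by
  induction n with
  | zero => simp
  | succ n ih =>
    have e : Complex.sin ((2 * (n + 1 : ℕ) + 1) * z) =
        Complex.sin ((2 * n + 1) * z) + 2 * Complex.cos ((2 * n + 2) * z) * Complex.sin z := by
      rw [show ((2 * (n + 1 : ℕ) + 1) * z : ℂ) = (2 * n + 2) * z + z by push_cast; ring,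
        show ((2 * n + 1) * z : ℂ) = (2 * n + 2) * z - z by ring, Complex.sin_add, Complex.sin_sub]
      ring
    have hc := norm_cos_le' ((2 * n + 2) * z)
    have him : ((2 * n + 2) * z).im = (2 * n + 2) * z.im := by
      simp
    rw [him, abs_mul, abs_of_nonneg (by positivity : (0:ℝ) ≤ 2 * n + 2)] at hc
    have hm : Real.exp (2 * n * |z.im|) ≤ Real.exp ((2 * n + 2) * |z.im|) := by
      gcongr; linarith
    rw [e]
    refine (norm_add_le _ _).trans ?_
    rw [norm_mul, norm_mul, Complex.norm_ofNat]
    push_cast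
    rw [show (2 * ((n:ℝ) + 1)) = 2 * n + 2 by ring]
    have hs := norm_nonneg (Complex.sin z)
    calc _ ≤ (2 * n + 1) * Real.exp ((2 * n + 2) * |z.im|) * ‖Complex.sin z‖
          + 2 * Real.exp ((2 * n + 2) * |z.im|) * ‖Complex.sin z‖ := by
            gcongr
            exact ih.trans (by gcongr)
      _ = _ := by ring

noncomputable def tt (ζ : ℂ) (n : ℕ) : ℂ :=
  2 * Complex.exp (Real.pi * Complex.I * (n + 1/2)^2 * ω) * (-1)^n *
    Complex.sin ((2 * n + 1) * (Real.pi * ζ))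

open Complex in
lemma th_sum (ζ : ℂ) : HasSum (tt ζ) (θf ζ) := by
  set f : ℤ → ℂ := fun n => Complex.exp ((Real.pi : ℂ) * Complex.I * ((n : ℂ) + 1 / 2) ^ 2 * ω
      + 2 * (Real.pi : ℂ) * Complex.I * ((n : ℂ) + 1 / 2) * (ζ + 1 / 2)) with hf
  have hsum : Summable f := by
    have : f = _ := funext fun n => th_term n ζ
    rw [this]
    exact ((summable_jacobiTheta₂_term_iff _ _).2 om_im_pos).mul_left _
  have h := hsum.hasSum.nat_add_neg_add_one.neg
  have e : θf ζ = - ∑' n, f n := rfl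
  rw [e]
  suffices hh : tt ζ = fun b : ℕ => -(f b + f (-(b + 1))) by rw [hh]; exact h
  funext n
  have hc : (-1 : ℂ)^n * Complex.sin ((2 * n + 1) * (Real.pi * ζ)) =
      -Complex.cos ((2 * n + 1) * (Real.pi * (ζ + 1/2))) := by
    rw [show ((2 * n + 1) * (Real.pi * (ζ + 1/2)) : ℂ) =
      ((2 * n + 1) * (Real.pi * ζ) + Real.pi / 2) + n * Real.pi by ring,
      Complex.cos_antiperiodic.add_nat_mul_eq, Complex.cos_add_pi_div_two]
    ring
  unfold tt
  rw [mul_assoc, hc, hf]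
  simp only
  push_cast
  rw [exp_add, exp_add, show (-((n:ℂ) + 1) + 1/2)^2 = (n + 1/2)^2 by ring]
  unfold Complex.cos
  rw [show (2 * Real.pi * I * (n + 1/2) * (ζ + 1/2) : ℂ) = (2 * n + 1) * (Real.pi * (ζ + 1/2)) * I by ring,
    show (2 * Real.pi * I * (-(n+1) + 1/2) * (ζ + 1/2) : ℂ) = -((2 * n + 1) * (Real.pi * (ζ + 1/2))) * I by ring]
  ring

noncomputable def rr : ℝ := Real.exp (-(Real.pi * (Real.sqrt 3 / 2)))

lemma rr_pos : 0 < rr := Real.exp_pos _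

lemma rr_lt : rr < 1/10 := by
  unfold rr
  rw [Real.exp_neg, one_div]
  apply inv_strictAnti₀ (by norm_num)
  have h3 : (1.7 : ℝ) ≤ Real.sqrt 3 := Real.le_sqrt_of_sq_le (by norm_num)
  have hp := Real.pi_gt_three
  have h1 : (2.5:ℝ) ≤ Real.pi * (Real.sqrt 3 / 2) := by nlinarith
  have h2 := Real.exp_le_exp.2 h1
  have h4 : Real.exp 2.5 = Real.exp 1 * Real.exp 1 * Real.exp 0.5 := by
    rw [← Real.exp_add, ← Real.exp_add]; norm_num
  have h5 := Real.exp_one_gt_d9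
  have h6 := Real.add_one_le_exp (0.5:ℝ)
  have h7 : (7:ℝ) ≤ Real.exp 1 * Real.exp 1 := by nlinarith
  nlinarith

lemma norm_q (n : ℕ) : ‖Complex.exp (Real.pi * Complex.I * (n + 1/2)^2 * ω)‖ =
    Real.exp (-(Real.pi * (Real.sqrt 3 / 2)) * (n + 1/2)^2) := by
  rw [Complex.norm_exp]
  congr 1
  rw [show (Real.pi * Complex.I * (n + 1/2)^2 * ω : ℂ) =
    ((Real.pi * (n + 1/2)^2 : ℝ) : ℂ) * (Complex.I * ω) by push_cast; ring, Complex.re_ofReal_mul]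
  simp [om_im]; ring

noncomputable def cc : ℝ := 2 * Real.exp (-(Real.pi * (Real.sqrt 3 / 2)) * (1/4))

lemma cc_pos : 0 < cc := by unfold cc; positivity

lemma two_n_le (n : ℕ) : (2 * n + 1 : ℝ) ≤ 3 ^ n := by
  have := one_add_mul_le_pow (a := (2:ℝ)) (by norm_num) n
  norm_num at this ⊢; linarith

lemma tt_bound (ζ : ℂ) (h : |ζ.im| ≤ Real.sqrt 3 / 4) (n : ℕ) :
    ‖tt ζ n‖ ≤ cc * ‖Complex.sin (Real.pi * ζ)‖ * (3/10)^n := by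
  unfold tt
  rw [norm_mul, norm_mul, norm_mul, norm_q, norm_pow, norm_neg, norm_one, one_pow,
    Complex.norm_ofNat, mul_one]
  have hs := norm_sin_odd (Real.pi * ζ) n
  have him : |((Real.pi : ℂ) * ζ).im| ≤ Real.pi * (Real.sqrt 3 / 4) := by
    rw [Complex.im_ofReal_mul, abs_mul, abs_of_pos Real.pi_pos]
    gcongr
  have he : Real.exp (2 * n * |((Real.pi : ℂ) * ζ).im|) ≤
      Real.exp (2 * n * (Real.pi * (Real.sqrt 3 / 4))) := by gcongr
  have key : Real.exp (-(Real.pi * (Real.sqrt 3 / 2)) * (n + 1/2)^2) *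
      Real.exp (2 * n * (Real.pi * (Real.sqrt 3 / 4))) =
      Real.exp (-(Real.pi * (Real.sqrt 3 / 2)) * (1/4)) * rr ^ (n^2) := by
    unfold rr
    rw [← Real.exp_nat_mul, ← Real.exp_add, ← Real.exp_add]
    congr 1; push_cast; ring
  have hr : rr ^ (n^2) ≤ (1/10)^n :=
    (pow_le_pow_of_le_one rr_pos.le (by linarith [rr_lt]) (by nlinarith)).trans
      (pow_le_pow_left₀ rr_pos.le rr_lt.le n)
  have h2 := two_n_le n
  calc _ ≤ 2 * Real.exp (-(Real.pi * (Real.sqrt 3 / 2)) * (n + 1/2)^2) *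
        ((2 * n + 1) * Real.exp (2 * n * (Real.pi * (Real.sqrt 3 / 4))) * ‖Complex.sin (Real.pi * ζ)‖) := by
        gcongr
        exact hs.trans (by gcongr)
    _ = 2 * (2 * n + 1) * ‖Complex.sin (Real.pi * ζ)‖ *
        (Real.exp (-(Real.pi * (Real.sqrt 3 / 2)) * (n + 1/2)^2) *
      Real.exp (2 * n * (Real.pi * (Real.sqrt 3 / 4)))) := by ring
    _ = cc * ‖Complex.sin (Real.pi * ζ)‖ * ((2 * n + 1) * rr ^ (n^2)) := by
        rw [key]; unfold cc; ring
    _ ≤ cc * ‖Complex.sin (Real.pi * ζ)‖ * (3 ^ n * (1/10) ^ n) := by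
        have := cc_pos
        gcongr
        exact pow_nonneg rr_pos.le _
    _ = _ := by rw [← mul_pow]; norm_num

lemma tt_zero (ζ : ℂ) : ‖tt ζ 0‖ = cc * ‖Complex.sin (Real.pi * ζ)‖ := by
  unfold tt
  rw [norm_mul, norm_mul, norm_mul, norm_q]
  simp [cc]
  left; norm_num

lemma th_lower (ζ : ℂ) (h : |ζ.im| ≤ Real.sqrt 3 / 4) :
    cc * (4/7) * ‖Complex.sin (Real.pi * ζ)‖ ≤ ‖θf ζ‖ := by
  have hs := th_sum ζ
  have h1 := (hasSum_nat_add_iff' 1).2 hs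
  simp only [Finset.sum_range_one] at h1
  have hg : HasSum (fun n : ℕ => cc * ‖Complex.sin (Real.pi * ζ)‖ * (3/10)^(n+1))
      (cc * ‖Complex.sin (Real.pi * ζ)‖ * (3/7)) := by
    have := (hasSum_geometric_of_lt_one (r := (3/10:ℝ)) (by norm_num) (by norm_num)).mul_left
      (cc * ‖Complex.sin (Real.pi * ζ)‖ * (3/10))
    have e1 : (fun n : ℕ => cc * ‖Complex.sin (Real.pi * ζ)‖ * (3/10)^(n+1)) =
        fun n : ℕ => cc * ‖Complex.sin (Real.pi * ζ)‖ * (3/10) * (3/10)^n := by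
      funext n; ring
    have e2 : cc * ‖Complex.sin (Real.pi * ζ)‖ * (3/7) =
        cc * ‖Complex.sin (Real.pi * ζ)‖ * (3/10) * (1 - 3/10)⁻¹ := by
      rw [show (1 - 3/10 : ℝ)⁻¹ = 10/7 by norm_num]; ring
    rw [e1, e2]; exact this
  have hb : ‖θf ζ - tt ζ 0‖ ≤ cc * ‖Complex.sin (Real.pi * ζ)‖ * (3/7) := by
    rw [← h1.tsum_eq]
    exact tsum_of_norm_bounded hg (fun n => tt_bound ζ h (n+1))
  have h3 := norm_sub_norm_le (tt ζ 0) (θf ζ)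
  rw [norm_sub_rev, tt_zero] at h3
  linarith

lemma th_zero : θf 0 = 0 := by
  have h := th_sum 0
  have : tt 0 = fun _ => 0 := by funext n; simp [tt]
  rw [this] at h
  exact h.unique hasSum_zero

lemma deriv_zero_ne : deriv θf 0 ≠ 0 := by
  intro h0
  have hd : HasDerivAt θf 0 0 := by
    have := (th_diff 0).hasDerivAt
    rwa [h0] at this
  have ho : θf =o[nhds 0] (fun z : ℂ => z) := by
    have := hd.isLittleO
    simpa [th_zero] using this
  have hO : (fun z : ℂ => Complex.sin (Real.pi * z)) =O[nhds 0] θf := by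
    refine Asymptotics.IsBigO.of_bound (cc * (4/7))⁻¹ ?_
    have hc : Filter.Tendsto (fun z : ℂ => |z.im|) (nhds 0) (nhds 0) := by
      have : Continuous (fun z : ℂ => |z.im|) := by fun_prop
      simpa using this.tendsto 0
    have h3 : (0:ℝ) < Real.sqrt 3 / 4 := by positivity
    filter_upwards [hc.eventually (gt_mem_nhds h3)] with z hz
    have := th_lower z hz.le
    have hcp := cc_pos
    rw [inv_mul_eq_div, le_div_iff₀ (by positivity)]
    linarith
  have hs : HasDerivAt (fun z : ℂ => Complex.sin (Real.pi * z)) 0 0 := by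
    rw [hasDerivAt_iff_isLittleO]
    simpa using hO.trans_isLittleO ho
  have hs2 : HasDerivAt (fun z : ℂ => Complex.sin (Real.pi * z)) Real.pi 0 := by
    have := ((hasDerivAt_id (0:ℂ)).const_mul (Real.pi:ℂ)).csin
    simpa using this
  have := hs.unique hs2
  exact Real.pi_ne_zero (by exact_mod_cast this.symm)

lemma lattice_P (m n : ℤ) : θf (m + n * ω) = 0 ∧ deriv θf (m + n * ω) ≠ 0 := by
  have h1 := inv_shift (fun z => θf z = 0 ∧ deriv θf z ≠ 0) ω (fun z => by
    rw [zero_add_om]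
    refine and_congr_right fun h => ?_
    rw [ne_eq, deriv_add_om z h]) m n
  have h2 := inv_shift (fun z => θf z = 0 ∧ deriv θf z ≠ 0) 1 (fun z => by
    rw [zero_add_one, ne_eq, deriv_add_one]) 0 m
  rw [zero_add, mul_one] at h2
  exact h1.2 (h2.2 ⟨th_zero, deriv_zero_ne⟩)

lemma zero_imp (ζ : ℂ) (h : θf ζ = 0) : ∃ m n : ℤ, ζ = (m : ℂ) + (n : ℂ) * ω := by
  set k : ℤ := round (ζ.im / (Real.sqrt 3 / 2)) with hk
  have h1 := (inv_shift (fun z => θf z = 0) ω zero_add_om ζ (-k)).2 h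
  have h3 : (0:ℝ) < Real.sqrt 3 / 2 := by positivity
  have him : |(ζ + (-k : ℤ) * ω).im| ≤ Real.sqrt 3 / 4 := by
    have e : (ζ + (-k : ℤ) * ω).im = (ζ.im / (Real.sqrt 3 / 2) - k) * (Real.sqrt 3 / 2) := by
      rw [sub_mul, div_mul_cancel₀ _ h3.ne']
      simp [om_im]; ring
    rw [e, abs_mul, abs_of_pos h3]
    have := abs_sub_round (ζ.im / (Real.sqrt 3 / 2))
    rw [← hk] at this
    nlinarith
  have h4 := th_lower _ him
  rw [h1, norm_zero] at h4
  have hcp := cc_pos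
  have h5 : Complex.sin (Real.pi * (ζ + (-k : ℤ) * ω)) = 0 := by
    rw [← norm_le_zero_iff]
    by_contra hh
    push Not at hh
    have : 0 < cc * (4/7) * ‖Complex.sin (Real.pi * (ζ + (-k : ℤ) * ω))‖ := by positivity
    linarith
  obtain ⟨m, hm⟩ := Complex.sin_eq_zero_iff.1 h5
  refine ⟨m, k, ?_⟩
  have hp : (Real.pi : ℂ) ≠ 0 := by exact_mod_cast Real.pi_ne_zero
  have : ζ + (-k : ℤ) * ω = m := by
    apply mul_left_cancel₀ hp; rw [hm]; ring
  push_cast at this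
  linear_combination this

/-- `θ` is entire, its zeros are exactly the lattice `ℤ + ωℤ`, and every zero is
simple (the complex derivative does not vanish there). -/
theorem theta_entire_zeros :
    Differentiable ℂ θf ∧
      (∀ ζ : ℂ, θf ζ = 0 ↔ ∃ m n : ℤ, ζ = (m : ℂ) + (n : ℂ) * ω) ∧
      ∀ m n : ℤ, deriv θf ((m : ℂ) + (n : ℂ) * ω) ≠ 0 := by
  exact ⟨th_diff, fun ζ => ⟨zero_imp ζ, by rintro ⟨m, n, rfl⟩; exact (lattice_P m n).1⟩,
    fun m n => (lattice_P m n).2⟩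
end

section
/- Let ω := exp(2πi/3), let a, b ∈ ℝ, set k := ω·a − b, and define g_k(ζ) := exp(2π·ζ·(k − conj(k))/√3) · θ(ζ + k)/θ(ζ). Then for all m, n ∈ ℤ and all ζ ∈ ℂ with θ(ζ) ≠ 0: g_k(ζ + m + n·ω) = exp(2πi·(a·m + b·n)) · g_k(ζ). -/
/-- `g_k(ζ) = exp(2π ζ (k − k̄)/√3) · θ(ζ + k)/θ(ζ)`. -/
noncomputable def gf (k ζ : ℂ) : ℂ :=
  Complex.exp (2 * (Real.pi : ℂ) * ζ * (k - starRingEnd ℂ k) / (Real.sqrt 3 : ℂ))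
    * θf (ζ + k) / θf ζ

theorem omega_sub_conj : ω - starRingEnd ℂ ω = Complex.I * (Real.sqrt 3 : ℂ) := by
  have h : ω = Complex.exp (((2 * Real.pi / 3 : ℝ) : ℂ) * Complex.I) := by
    unfold ω
    congr 1
    push_cast
    ring
  have him : ω.im = Real.sqrt 3 / 2 := by
    rw [h, Complex.exp_ofReal_mul_I_im,
      show 2 * Real.pi / 3 = Real.pi - Real.pi / 3 by ring, Real.sin_pi_sub, Real.sin_pi_div_three]
  rw [Complex.sub_conj, him]
  push_cast
  ring

theorem theta_shift (m n : ℤ) (ζ : ℂ) :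
    θf (ζ + (m : ℂ) + (n : ℂ) * ω) =
      Complex.exp ((Real.pi : ℂ) * Complex.I * m - (Real.pi : ℂ) * Complex.I * (n : ℂ) ^ 2 * ω
        - 2 * (Real.pi : ℂ) * Complex.I * n * (ζ + 1 / 2)) * θf ζ := by
  unfold θf
  rw [mul_neg, ← tsum_mul_left]
  congr 1
  rw [← (Equiv.addRight n).tsum_eq (fun j : ℤ => Complex.exp ((Real.pi : ℂ) * Complex.I * m
    - (Real.pi : ℂ) * Complex.I * (n : ℂ) ^ 2 * ω
        - 2 * (Real.pi : ℂ) * Complex.I * n * (ζ + 1 / 2)) *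
      Complex.exp ((Real.pi : ℂ) * Complex.I * ((j : ℂ) + 1 / 2) ^ 2 * ω
      + 2 * (Real.pi : ℂ) * Complex.I * ((j : ℂ) + 1 / 2) * (ζ + 1 / 2)))]
  refine tsum_congr fun j => ?_
  rw [← Complex.exp_add, Complex.exp_eq_exp_iff_exists_int]
  refine ⟨j * m, ?_⟩
  simp only [Equiv.coe_addRight]
  push_cast
  ring

/-- Quasi-periodicity of `g_k` for `k = ωa − b` with `a, b` real:
`g_k(ζ + m + nω) = exp(2πi(am + bn)) g_k(ζ)`. -/
theorem gf_quasi_periodicity (a b : ℝ) (m n : ℤ) (ζ : ℂ) (hζ : θf ζ ≠ 0) :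
    gf (ω * (a : ℂ) - (b : ℂ)) (ζ + (m : ℂ) + (n : ℂ) * ω)
      = Complex.exp (2 * (Real.pi : ℂ) * Complex.I * ((a : ℂ) * (m : ℂ) + (b : ℂ) * (n : ℂ)))
          * gf (ω * (a : ℂ) - (b : ℂ)) ζ := by
  have hs : (Real.sqrt 3 : ℂ) ≠ 0 := by
    rw [Ne, Complex.ofReal_eq_zero]
    positivity
  have hk : (ω * (a : ℂ) - (b : ℂ)) - starRingEnd ℂ (ω * (a : ℂ) - (b : ℂ))
      = Complex.I * (Real.sqrt 3 : ℂ) * a := by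
    rw [← omega_sub_conj]
    simp only [map_sub, map_mul, Complex.conj_ofReal]
    ring
  have he : ∀ z : ℂ, 2 * (Real.pi : ℂ) * z * (Complex.I * (Real.sqrt 3 : ℂ) * a)
      / (Real.sqrt 3 : ℂ) = 2 * (Real.pi : ℂ) * z * Complex.I * a := by
    intro z
    field_simp
  unfold gf
  rw [hk, he, he, theta_shift,
    show ζ + (m : ℂ) + (n : ℂ) * ω + (ω * (a : ℂ) - (b : ℂ))
      = (ζ + (ω * (a : ℂ) - (b : ℂ))) + (m : ℂ) + (n : ℂ) * ω by ring, theta_shift]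
  rw [div_eq_iff (mul_ne_zero (Complex.exp_ne_zero _) hζ)]
  generalize θf (ζ + (ω * (a : ℂ) - (b : ℂ))) = T
  have e : ∀ A B C D E S : ℂ, S ≠ 0 → A + B = C + D + E →
      Complex.exp A * (Complex.exp B * T) =
      Complex.exp C * (Complex.exp D * T / S) * (Complex.exp E * S) := by
    intro A B C D E S hS h
    have h2 : Complex.exp A * Complex.exp B
        = Complex.exp C * Complex.exp D * Complex.exp E := by
      rw [← Complex.exp_add, h, Complex.exp_add, Complex.exp_add]
    rw [← mul_assoc, h2]
    field_simp
  apply e _ _ _ _ _ _ hζ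
  ring
end

section
/- Let ω := exp(2πi/3), let k ∈ ℂ, and define g_k(ζ) := exp(2π·ζ·(k − conj(k))/√3) · θ(ζ + k)/θ(ζ). Then for all p, q ∈ ℤ and all ζ ∈ ℂ with θ(ζ) ≠ 0: g_{k + p·ω − q}(ζ) = (−1)^{p+q} · exp(−2πi·k·p − πi·p²·ω) · g_k(ζ). -/
lemma aux_neg_one (m : ℤ) : (-1 : ℂ) ^ m = Complex.exp ((m : ℂ) * ((Real.pi : ℂ) * Complex.I)) := by
  rw [Complex.exp_int_mul, Complex.exp_pi_mul_I]

lemma aux_omega : ω - starRingEnd ℂ ω = (Real.sqrt 3 : ℂ) * Complex.I := by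
  have h : ω = Complex.exp (((2 * Real.pi / 3 : ℝ) : ℂ) * Complex.I) := by
    unfold ω
    congr 1
    push_cast
    ring
  have hs : Real.sin (2 * Real.pi / 3) = Real.sqrt 3 / 2 := by
    rw [← Real.sin_pi_div_three, ← Real.sin_pi_sub]
    congr 1
    ring
  rw [Complex.sub_conj, h, Complex.exp_ofReal_mul_I_im, hs]
  push_cast
  ring

lemma aux_theta (z : ℂ) (p q : ℤ) : θf (z + (p : ℂ) * ω - (q : ℂ)) =
    (-1 : ℂ) ^ (p + q) * Complex.exp (-2 * (Real.pi : ℂ) * Complex.I * z * (p : ℂ)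
            - (Real.pi : ℂ) * Complex.I * (p : ℂ) ^ 2 * ω) * θf z := by
  unfold θf
  rw [mul_neg, ← tsum_mul_left, neg_inj, ← (Equiv.addRight p).tsum_eq (fun n : ℤ => _ * _)]
  congr 1
  ext n
  rw [aux_neg_one, ← Complex.exp_add, ← Complex.exp_add, Complex.exp_eq_exp_iff_exists_int]
  refine ⟨-(p + q + n * q), ?_⟩
  simp only [Equiv.coe_addRight]
  push_cast
  ring

/-- Shifting the parameter: `g_{k + pω − q}(ζ) = (−1)^{p+q} e^{−2πikp − πip²ω} g_k(ζ)`. -/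
theorem gf_parameter_shift (k : ℂ) (p q : ℤ) (ζ : ℂ) (hζ : θf ζ ≠ 0) :
    gf (k + (p : ℂ) * ω - (q : ℂ)) ζ
      = (-1 : ℂ) ^ (p + q) *
          Complex.exp (-2 * (Real.pi : ℂ) * Complex.I * k * (p : ℂ)
            - (Real.pi : ℂ) * Complex.I * (p : ℂ) ^ 2 * ω) * gf k ζ := by
  have h3 : (Real.sqrt 3 : ℂ) ≠ 0 := by
    simp
  have e1 : ζ + (k + (p : ℂ) * ω - (q : ℂ)) = (ζ + k) + (p : ℂ) * ω - (q : ℂ) := by ring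
  have e2 : (k + (p : ℂ) * ω - (q : ℂ)) - starRingEnd ℂ (k + (p : ℂ) * ω - (q : ℂ))
      = (k - starRingEnd ℂ k) + p * ((Real.sqrt 3 : ℂ) * Complex.I) := by
    rw [← aux_omega]
    simp only [map_sub, map_add, map_mul, map_intCast]
    ring
  unfold gf
  rw [e1, e2, aux_theta]
  have e3 : Complex.exp (2 * (Real.pi : ℂ) * ζ * ((k - starRingEnd ℂ k) + p * ((Real.sqrt 3 : ℂ) * Complex.I)) / (Real.sqrt 3 : ℂ)) * Complex.exp (-2 * (Real.pi : ℂ) * Complex.I * (ζ + k) * (p : ℂ)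
            - (Real.pi : ℂ) * Complex.I * (p : ℂ) ^ 2 * ω) = Complex.exp (-2 * (Real.pi : ℂ) * Complex.I * k * (p : ℂ)
            - (Real.pi : ℂ) * Complex.I * (p : ℂ) ^ 2 * ω) * Complex.exp (2 * (Real.pi : ℂ) * ζ * (k - starRingEnd ℂ k) / (Real.sqrt 3 : ℂ)) := by
    rw [← Complex.exp_add, ← Complex.exp_add]
    congr 1
    field_simp
    ring
  linear_combination ((-1 : ℂ) ^ (p + q) * θf (ζ + k) / θf ζ) * e3
end
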